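/- arXiv:2412.20700 — 2 statements merged into one kernel-verified Lean document; each statement's English description precedes it below -/
import Mathlib

section
/- Fix an integer n ≥ 1. The invariant [X | m] ~ dm holds at every step of optimal_uniform(n): for every k ∈ ℕ, every m ≥ 1, and every i with 1 ≤ i ≤ m, μ({b : X_k(b) = i and m_k(b) = m}) = μ({b : m_k(b) = m}) / m. -/
open MeasureTheory
open scoped ENNReal NNReal

/-- One step of the `optimal_uniform n` algorithm: from state `(X, m)`, driven by a
fair coin flip `B`.  The state with `m = n` is absorbing. -/
def kyStep (n : ℕ) (s : ℕ × ℕ) (B : Bool) : ℕ × ℕ :=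
  if s.2 = n then s
  else
    let X' := s.1 + (if B then s.2 else 0)
    let m' := 2 * s.2
    if n ≤ m' then (if X' ≤ n then (X', n) else (X' - n, m' - n)) else (X', m')

/-- The state `(X_k b, m_k b)` after `k` coin flips, starting from `(1, 1)`. -/
def kyState (n : ℕ) (b : ℕ → Bool) : ℕ → ℕ × ℕ
  | 0 => (1, 1)
  | k + 1 => kyStep n (kyState n b k) (b k)

/-- The number of flips used by `optimal_uniform n`: the first time `m_k = n`
(`⊤` if the algorithm never terminates). -/
noncomputable def kyT (n : ℕ) (b : ℕ → Bool) : ℕ∞ :=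
  ⨅ (k : ℕ) (_ : (kyState n b k).2 = n), (k : ℕ∞)

theorem measure_eq_sum_inter_fiber {Ω β : Type*} [MeasurableSpace Ω] [MeasurableSpace β]
    [MeasurableSingletonClass β] (μ : Measure Ω) {g : Ω → β} (hg : Measurable g)
    (S : Set Ω) (T : Finset β) (hT : ∀ b ∈ S, g b ∈ T) :
    μ S = ∑ y ∈ T, μ (S ∩ {b | g b = y}) := by
  have hfib : ∀ y, MeasurableSet (g ⁻¹' {y}) := fun y => hg (measurableSet_singleton y)
  have h := sum_measure_preimage_singleton (μ := μ.restrict S) (f := g) T (fun y _ => hfib y)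
  rw [Measure.restrict_apply (hg T.measurableSet)] at h
  have hS : g ⁻¹' (T : Set β) ∩ S = S := Set.inter_eq_right.2 fun b hb => hT b hb
  rw [hS] at h
  rw [← h]
  refine Finset.sum_congr rfl fun y _ => ?_
  rw [Measure.restrict_apply (hfib y), Set.inter_comm]
  rfl

/-- A fair coin flip halves the measure of an event depending only on the earlier flips. -/
theorem measure_inter_flip (μ : Measure (ℕ → Bool))
    (hμ : ∀ (k : ℕ) (f : ℕ → Bool), μ {b | ∀ i < k, b i = f i} = (2 : ℝ≥0∞)⁻¹ ^ k)
    (k : ℕ) (S : Set (ℕ → Bool))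
    (hS : ∀ b b' : ℕ → Bool, (∀ i < k, b i = b' i) → b ∈ S → b' ∈ S) (B : Bool) :
    μ (S ∩ {b | b k = B}) = 2⁻¹ * μ S := by
  have hg : Measurable (fun (b : ℕ → Bool) (i : Fin k) => b i) := by fun_prop
  rw [measure_eq_sum_inter_fiber μ hg (S ∩ {b | b k = B}) Finset.univ (by simp),
    measure_eq_sum_inter_fiber μ hg S Finset.univ (by simp), Finset.mul_sum]
  refine Finset.sum_congr rfl fun y _ => ?_
  set f : ℕ → Bool := fun i => if h : i < k then y ⟨i, h⟩ else B with hf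
  have hfib : ∀ b : ℕ → Bool, (fun i : Fin k => b i) = y ↔ ∀ i < k, b i = f i := by
    intro b
    constructor
    · intro h i hi
      have := congrFun h ⟨i, hi⟩
      simpa [hf, hi] using this
    · intro h
      funext i
      simpa [hf] using h i i.2
  have hfk : f k = B := by simp [hf]
  simp only [hfib]
  by_cases hfS : f ∈ S
  · have hmem : ∀ b : ℕ → Bool, (∀ i < k, b i = f i) → b ∈ S := fun b hb =>
      hS f b (fun i hi => (hb i hi).symm) hfS
    have h1 : S ∩ {b | b k = B} ∩ {b | ∀ i < k, b i = f i} = {b | ∀ i < k + 1, b i = f i} := by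
      ext b
      simp only [Set.mem_inter_iff, Set.mem_ofPred_eq, Nat.lt_succ_iff_lt_or_eq]
      constructor
      · rintro ⟨⟨_, h2⟩, h3⟩ i (hi | rfl)
        · exact h3 i hi
        · rw [h2, hfk]
      · intro h
        have h3 : ∀ i < k, b i = f i := fun i hi => h i (Or.inl hi)
        exact ⟨⟨hmem b h3, by rw [h k (Or.inr rfl), hfk]⟩, h3⟩
    have h2 : S ∩ {b | ∀ i < k, b i = f i} = {b | ∀ i < k, b i = f i} :=
      Set.inter_eq_right.2 hmem
    rw [h1, h2, hμ, hμ, pow_succ, mul_comm]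
  · have h2 : S ∩ {b | ∀ i < k, b i = f i} = ∅ := by
      ext b
      simp only [Set.mem_inter_iff, Set.mem_ofPred_eq, Set.mem_empty_iff_false, iff_false]
      exact fun h => hfS (hS b f h.2 h.1)
    rw [Set.inter_right_comm, h2]
    simp

theorem measurable_kyState (n k : ℕ) : Measurable fun b : ℕ → Bool => kyState n b k := by
  induction k with
  | zero => exact measurable_const
  | succ k ih =>
    have h : Measurable fun p : (ℕ × ℕ) × Bool => kyStep n p.1 p.2 := Measurable.of_discrete
    exact h.comp (ih.prodMk (measurable_pi_apply k))

theorem kyState_congr (n k : ℕ) (b b' : ℕ → Bool) (h : ∀ i < k, b i = b' i) :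
    kyState n b k = kyState n b' k := by
  induction k with
  | zero => rfl
  | succ k ih =>
    simp only [kyState]
    rw [ih fun i hi => h i (by omega), h k (by omega)]

theorem kyState_bounds (n : ℕ) (hn : 1 ≤ n) (b : ℕ → Bool) (k : ℕ) :
    1 ≤ (kyState n b k).1 ∧ (kyState n b k).1 ≤ (kyState n b k).2 ∧ (kyState n b k).2 ≤ n := by
  induction k with
  | zero => simpa [kyState] using hn
  | succ k ih =>
    simp only [kyState, kyStep]
    generalize kyState n b k = s at ih ⊢
    cases b k <;> simp only [Bool.false_eq_true, if_true, if_false] <;> split_ifs <;>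
      (try simp only) <;> omega

theorem sum_flip_eq_half (m t : ℕ) (ht : 1 ≤ t) (htm : t ≤ 2 * m) :
    ∑ x ∈ Finset.Icc 1 m, ∑ B : Bool,
      (if x + (if B then m else 0) = t then (2 : ℝ≥0∞)⁻¹ else 0) = 2⁻¹ := by
  rw [Finset.sum_eq_single (if t ≤ m then t else t - m)]
  · rw [Finset.sum_eq_single (decide (m < t))]
    · rw [if_pos]
      by_cases h : t ≤ m
      · simp [h, h.not_gt]
      · simp only [h, if_false, not_le.1 h, decide_true, if_true]
        omega
    · intro B _ hB
      rw [if_neg]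
      by_cases h : t ≤ m
      · cases B
        · simp [h] at hB
        · simp only [h, if_true]
          omega
      · cases B
        · simp only [h, if_false, Bool.false_eq_true]
          omega
        · simp [not_le.1 h] at hB
    · simp
  · intro x hx hxt
    rw [Finset.mem_Icc] at hx
    refine Finset.sum_eq_zero fun B _ => if_neg ?_
    cases B <;> simp <;> split_ifs at hxt <;> omega
  · intro h
    exfalso
    apply h
    rw [Finset.mem_Icc]
    split_ifs <;> omega

/-- Starting from a fixed level `m₀`, a step of the algorithm reaches all states `(i, m)` of a
given level `m` with the same total weight. -/
theorem exists_kyStep_weight (n m₀ m : ℕ) (hm₀ : m₀ ≤ n) :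
    ∃ c : ℝ≥0∞, ∀ i, 1 ≤ i → i ≤ m →
      ∑ x ∈ Finset.Icc 1 m₀, ∑ B : Bool,
        (if kyStep n (x, m₀) B = (i, m) then (2 : ℝ≥0∞)⁻¹ else 0) = c := by
  have shifted : ∀ d, m + d ≤ 2 * m₀ →
      (∀ i, 1 ≤ i → i ≤ m → ∀ x ∈ Finset.Icc 1 m₀, ∀ B : Bool,
        (kyStep n (x, m₀) B = (i, m) ↔ x + (if B then m₀ else 0) = i + d)) →
      ∃ c : ℝ≥0∞, ∀ i, 1 ≤ i → i ≤ m →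
        ∑ x ∈ Finset.Icc 1 m₀, ∑ B : Bool,
          (if kyStep n (x, m₀) B = (i, m) then (2 : ℝ≥0∞)⁻¹ else 0) = c := by
    intro d hd h
    refine ⟨2⁻¹, fun i hi him => ?_⟩
    refine Eq.trans ?_ (sum_flip_eq_half m₀ (i + d) (by omega) (by omega))
    exact Finset.sum_congr rfl fun x hx => Finset.sum_congr rfl fun B _ => by
      simp only [h i hi him x hx B]
  by_cases h0 : m₀ = n
  · subst h0
    by_cases hm : m = m₀
    · subst hm
      refine ⟨2 * 2⁻¹, fun i hi him => ?_⟩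
      rw [Finset.sum_eq_single i]
      · simp [kyStep]
      · intro x _ hx
        simp [kyStep, hx]
      · intro h
        exact absurd (Finset.mem_Icc.2 ⟨hi, him⟩) h
    · exact ⟨0, fun i _ _ => Finset.sum_eq_zero fun x _ => Finset.sum_eq_zero fun B _ => by
        simp [kyStep, Ne.symm hm]⟩
  · by_cases hA : 2 * m₀ < n ∧ m = 2 * m₀
    · refine shifted 0 (by omega) fun i hi him x hx B => ?_
      simp [kyStep, h0, hA.1.not_ge, hA.2]
    by_cases hB : n ≤ 2 * m₀ ∧ m = n
    · refine shifted 0 (by omega) fun i hi him x hx B => ?_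
      simp only [kyStep, h0, if_false, hB.1, if_true]
      generalize x + (if B then m₀ else 0) = X
      split_ifs <;> simp only [Prod.mk.injEq] <;> omega
    by_cases hC : n ≤ 2 * m₀ ∧ m = 2 * m₀ - n
    · refine shifted n (by omega) fun i hi him x hx B => ?_
      simp only [kyStep, h0, if_false, hC.1, if_true]
      generalize x + (if B then m₀ else 0) = X
      split_ifs <;> simp only [Prod.mk.injEq] <;> omega
    · refine ⟨0, fun i _ _ => Finset.sum_eq_zero fun x _ => Finset.sum_eq_zero fun B _ => ?_⟩
      refine if_neg ?_
      simp only [kyStep, h0, if_false]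
      generalize x + (if B then m₀ else 0) = X
      split_ifs <;> simp only [Prod.mk.injEq] <;> omega

theorem measure_kyState_succ (n : ℕ) (hn : 1 ≤ n) (μ : Measure (ℕ → Bool))
    (hμ : ∀ (k : ℕ) (f : ℕ → Bool), μ {b | ∀ i < k, b i = f i} = (2 : ℝ≥0∞)⁻¹ ^ k)
    (k : ℕ) (s : ℕ × ℕ) :
    μ {b | kyState n b (k + 1) = s} =
      ∑ m ∈ Finset.Icc 1 n, ∑ x ∈ Finset.Icc 1 m, ∑ B : Bool,
        (if kyStep n (x, m) B = s then (2 : ℝ≥0∞)⁻¹ else 0) * μ {b | kyState n b k = (x, m)} := by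
  have hst := measurable_kyState n k
  rw [measure_eq_sum_inter_fiber μ hst.snd _ (Finset.Icc 1 n) fun b _ => by
    have := kyState_bounds n hn b k
    rw [Finset.mem_Icc]
    omega]
  refine Finset.sum_congr rfl fun m _ => ?_
  rw [measure_eq_sum_inter_fiber μ hst.fst _ (Finset.Icc 1 m) fun b hb => by
    have := kyState_bounds n hn b k
    have hb2 : (kyState n b k).2 = m := hb.2
    rw [Finset.mem_Icc]
    omega]
  refine Finset.sum_congr rfl fun x _ => ?_
  rw [measure_eq_sum_inter_fiber μ (measurable_pi_apply k) _ Finset.univ (by simp)]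
  refine Finset.sum_congr rfl fun B _ => ?_
  have hset : {b | kyState n b (k + 1) = s} ∩ {b | (kyState n b k).2 = m} ∩
      {b | (kyState n b k).1 = x} ∩ {b | b k = B} =
      {b | kyStep n (x, m) B = s} ∩ ({b | kyState n b k = (x, m)} ∩ {b | b k = B}) := by
    ext b
    simp only [Set.mem_inter_iff, Set.mem_ofPred_eq, kyState]
    constructor
    · rintro ⟨⟨⟨h1, h2⟩, h3⟩, h4⟩
      have h5 : kyState n b k = (x, m) := Prod.ext h3 h2
      rw [h5, h4] at h1
      exact ⟨h1, h5, h4⟩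
    · rintro ⟨h1, h5, h4⟩
      rw [h5, h4]
      exact ⟨⟨⟨h1, rfl⟩, rfl⟩, rfl⟩
  rw [hset]
  split_ifs with h
  · rw [← measure_inter_flip μ hμ k _ (fun b b' hbb hb => ?_) B]
    · simp [h]
    · rw [Set.mem_ofPred_eq, ← kyState_congr n k b b' hbb]
      exact hb
  · simp [h]

theorem exists_measure_kyState_eq (n : ℕ) (hn : 1 ≤ n) (μ : Measure (ℕ → Bool))
    (hμ : ∀ (k : ℕ) (f : ℕ → Bool), μ {b | ∀ i < k, b i = f i} = (2 : ℝ≥0∞)⁻¹ ^ k)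
    (k : ℕ) : ∃ u : ℕ → ℝ≥0∞, ∀ m i, 1 ≤ i → i ≤ m →
      μ {b | kyState n b k = (i, m)} = u m := by
  induction k with
  | zero =>
    refine ⟨fun m => if m = 1 then μ Set.univ else 0, fun m i hi him => ?_⟩
    by_cases hm : m = 1
    · obtain rfl : i = 1 := by omega
      simp [kyState, hm]
    · simp [kyState, hm, Ne.symm hm]
  | succ k ih =>
    obtain ⟨u, hu⟩ := ih
    have hc : ∀ m m₀ : ℕ, ∃ c : ℝ≥0∞, m₀ ≤ n → ∀ i, 1 ≤ i → i ≤ m →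
        ∑ x ∈ Finset.Icc 1 m₀, ∑ B : Bool,
          (if kyStep n (x, m₀) B = (i, m) then (2 : ℝ≥0∞)⁻¹ else 0) = c := by
      intro m m₀
      by_cases h : m₀ ≤ n
      · obtain ⟨c, hc⟩ := exists_kyStep_weight n m₀ m h
        exact ⟨c, fun _ => hc⟩
      · exact ⟨0, fun h' => absurd h' h⟩
    choose c hc using hc
    refine ⟨fun m => ∑ m₀ ∈ Finset.Icc 1 n, c m m₀ * u m₀, fun m i hi him => ?_⟩
    rw [measure_kyState_succ n hn μ hμ]
    refine Finset.sum_congr rfl fun m₀ hm₀ => ?_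
    rw [← hc m m₀ (Finset.mem_Icc.1 hm₀).2 i hi him, Finset.sum_mul]
    refine Finset.sum_congr rfl fun x hx => ?_
    rw [Finset.mem_Icc] at hx
    rw [hu m₀ x hx.1 hx.2, Finset.sum_mul]

/-- The invariant `[X | m] ~ dm` holds at every step of
`optimal_uniform n`: for every number of flips `k`, every `m ≥ 1` and every
`1 ≤ i ≤ m`, the probability that the state after `k` flips is `(i, m)` equals the
probability that the second component is `m`, divided by `m`. -/
theorem optimal_uniform_invariant (n : ℕ) (hn : 1 ≤ n)
    (μ : Measure (ℕ → Bool)) [IsProbabilityMeasure μ]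
    (hμ : ∀ (k : ℕ) (f : ℕ → Bool), μ {b | ∀ i < k, b i = f i} = (2 : ℝ≥0∞)⁻¹ ^ k) :
    ∀ (k m : ℕ), 1 ≤ m → ∀ i : ℕ, 1 ≤ i → i ≤ m →
      μ {b | (kyState n b k).1 = i ∧ (kyState n b k).2 = m}
        = μ {b | (kyState n b k).2 = m} / (m : ℝ≥0∞) := by
  intro k m hm i hi him
  obtain ⟨u, hu⟩ := exists_measure_kyState_eq n hn μ hμ k
  have hpair : ∀ x, {b | (kyState n b k).1 = x ∧ (kyState n b k).2 = m} =
      {b | kyState n b k = (x, m)} := fun x => by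
    ext b
    simp [Prod.ext_iff]
  have htotal : μ {b | (kyState n b k).2 = m} = m * u m := by
    rw [measure_eq_sum_inter_fiber μ (measurable_kyState n k).fst _ (Finset.Icc 1 m) fun b hb => by
      have := kyState_bounds n hn b k
      have hb2 : (kyState n b k).2 = m := hb
      rw [Finset.mem_Icc]
      omega]
    rw [Finset.sum_congr rfl (g := fun _ => u m)]
    · simp
    · intro x hx
      rw [Finset.mem_Icc] at hx
      rw [Set.inter_comm, ← hu m x hx.1 hx.2, ← hpair]
      rfl
  rw [hpair, hu m i hi him, htotal, mul_comm,
    ENNReal.mul_div_cancel_right (by exact_mod_cast (by omega : m ≠ 0)) (ENNReal.natCast_ne_top m)]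
end

section
/- A DDG (S_i)_{i ∈ I} for a probability mass function p is optimal if and only if both of the following hold: for every outcome i ∈ I and every level j ∈ ℕ, S_i contains at most one bit string of length j; and for no outcome i ∈ I does there exist k ∈ ℕ such that for every j ≥ k, S_i contains a bit string of length j. -/
open scoped ENNReal NNReal

/-- The weight `2^{-|w|}` of a bit string `w` (the probability that the string of fair
coin flips starts with `w`). -/
noncomputable def ddgWt (w : List Bool) : ℝ≥0 := (2 : ℝ≥0)⁻¹ ^ w.length

/-- A DDG (discrete distribution generating tree) for a probability mass function `p`
on an outcome set `I`: a family `S i` of pairwise disjoint sets of finite bit strings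
whose union is prefix-free, with `∑_{w ∈ S i} 2^{-|w|} = p i` for every `i` and total
mass `1`. -/
structure IsDDG {I : Type*} (p : I → ℝ≥0) (S : I → Set (List Bool)) : Prop where
  pairwise_disjoint : Pairwise (Function.onFun Disjoint S)
  prefixFree : ∀ w ∈ ⋃ i, S i, ∀ v ∈ ⋃ i, S i, w <+: v → w = v
  mass : ∀ i, ∑' w : (S i), ddgWt (w : List Bool) = p i
  total : ∑' w : (⋃ i, S i : Set (List Bool)), ddgWt (w : List Bool) = 1

/-- `P(N > j)`, where `N` is the number of flips used by the DDG `S`: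
`1 - ∑_{w ∈ S, |w| ≤ j} 2^{-|w|}`. -/
noncomputable def ddgTail {I : Type*} (S : I → Set (List Bool)) (j : ℕ) : ℝ≥0 :=
  1 - ∑' w : ({w ∈ ⋃ i, S i | w.length ≤ j} : Set (List Bool)), ddgWt (w : List Bool)

/-- A DDG for `p` is optimal if its flip count is stochastically dominated by that of
any other DDG for `p`: `P(N > j) ≤ P(N' > j)` for all `j`. -/
def IsOptimalDDG {I : Type*} (p : I → ℝ≥0) (S : I → Set (List Bool)) : Prop :=
  IsDDG p S ∧ ∀ S' : I → Set (List Bool), IsDDG p S' → ∀ j : ℕ, ddgTail S j ≤ ddgTail S' j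

/-- The number of leaves at level `j`, counted in units of `2^{-j}`, when a leaf sequence with
`c m` leaves at level `m` is truncated at level `j`. -/
def dyadicCount (c : ℕ → ℕ) : ℕ → ℕ
  | 0 => c 0
  | j + 1 => 2 * dyadicCount c j + c (j + 1)

theorem sum_range_eq_dyadicCount {R : Type*} [CommSemiring R] {r : R} (hr : 2 * r = 1)
    (c : ℕ → ℕ) (j : ℕ) :
    ∑ m ∈ Finset.range (j + 1), (c m : R) * r ^ m = dyadicCount c j * r ^ j := by
  induction j with
  | zero => simp [dyadicCount]
  | succ j ih =>
    rw [Finset.sum_range_succ, ih]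
    simp only [dyadicCount, pow_succ]
    push_cast
    calc (dyadicCount c j : R) * r ^ j + c (j + 1) * (r ^ j * r)
        = (2 * r) * (dyadicCount c j * r ^ j) + c (j + 1) * (r ^ j * r) := by rw [hr, one_mul]
      _ = (2 * dyadicCount c j + c (j + 1)) * (r ^ j * r) := by ring

theorem hasSum_dyadicCount_remainder {c : ℕ → ℕ} {x : ℝ}
    (h : HasSum (fun j => (c j : ℝ) * (1 / 2) ^ j) x) (j : ℕ) :
    HasSum (fun m => (c (m + (j + 1)) : ℝ) * (1 / 2 / 2 ^ m)) (2 ^ j * x - dyadicCount c j) := by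
  have hpow : (2 : ℝ) ^ j * (1 / 2) ^ j = 1 := by rw [← mul_pow]; norm_num
  have h1 := ((hasSum_nat_add_iff' (j + 1)).2 h).mul_left (2 ^ j)
  rw [sum_range_eq_dyadicCount (by norm_num)] at h1
  have h2 : ∀ m, (c (m + (j + 1)) : ℝ) * (1 / 2 / 2 ^ m) =
      2 ^ j * (c (m + (j + 1)) * (1 / 2) ^ (m + (j + 1))) := fun m => by
    rw [pow_add, pow_succ]
    have : (1 : ℝ) / 2 ^ m = (1 / 2) ^ m := by simp
    linear_combination (-(c (m + (j + 1)) : ℝ) * (1 / 2) ^ m * (1 / 2)) * hpow +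
      (c (m + (j + 1)) : ℝ) * (1 / 2) * this
  simp_rw [h2]
  rwa [show 2 ^ j * x - dyadicCount c j = 2 ^ j * (x - dyadicCount c j * (1 / 2) ^ j) by
    linear_combination (dyadicCount c j : ℝ) * hpow]

theorem dyadicCount_le {c : ℕ → ℕ} {x : ℝ}
    (h : HasSum (fun j => (c j : ℝ) * (1 / 2) ^ j) x) (j : ℕ) :
    (dyadicCount c j : ℝ) ≤ 2 ^ j * x :=
  sub_nonneg.1 <| (hasSum_dyadicCount_remainder h j).nonneg fun m => by positivity

theorem dyadicCount_le_floor {c : ℕ → ℕ} {x : ℝ}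
    (h : HasSum (fun j => (c j : ℝ) * (1 / 2) ^ j) x) (j : ℕ) :
    dyadicCount c j ≤ ⌊2 ^ j * x⌋₊ :=
  Nat.le_floor (dyadicCount_le h j)

theorem floor_two_mul_le (x : ℝ) : ⌊2 * x⌋₊ ≤ 2 * ⌊x⌋₊ + 1 := by
  have h := Nat.lt_floor_add_one x
  refine Nat.lt_succ_iff.1 <| (Nat.floor_lt' (by omega)).2 ?_
  push_cast
  linarith

theorem two_mul_floor_le {x : ℝ} (hx : 0 ≤ x) : 2 * ⌊x⌋₊ ≤ ⌊2 * x⌋₊ := by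
  apply Nat.le_floor
  push_cast
  linarith [Nat.floor_le hx]

theorem dyadicCount_eq_floor_iff {c : ℕ → ℕ} {x : ℝ} (hx : x ≤ 1)
    (h : HasSum (fun j => (c j : ℝ) * (1 / 2) ^ j) x) :
    (∀ j, dyadicCount c j = ⌊2 ^ j * x⌋₊) ↔
      (∀ j, c j ≤ 1) ∧ ¬ ∃ k, ∀ j, k ≤ j → c j ≠ 0 := by
  constructor
  · intro hfl
    refine ⟨fun j => ?_, ?_⟩
    · cases j with
      | zero =>
        have h0 := hfl 0
        simp only [dyadicCount, pow_zero, one_mul] at h0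
        rw [h0]
        exact Nat.floor_le_of_le (by simpa using hx)
      | succ j =>
        have h1 := hfl (j + 1)
        have h2 := floor_two_mul_le (2 ^ j * x)
        rw [dyadicCount, hfl j, pow_succ', mul_assoc] at h1
        omega
    · rintro ⟨k, hk⟩
      have h1 : (1 : ℝ) ≤ 2 ^ k * x - dyadicCount c k := by
        refine hasSum_le (fun m => ?_) (hasSum_geometric_two' 1) (hasSum_dyadicCount_remainder h k)
        have : (1 : ℝ) ≤ c (m + (k + 1)) := by
          exact_mod_cast Nat.one_le_iff_ne_zero.2 (hk _ (by omega))
        exact le_mul_of_one_le_left (by positivity) this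
      have h2 := Nat.lt_floor_add_one (2 ^ k * x)
      rw [← hfl k] at h2
      linarith
  · rintro ⟨hle, hne⟩ j
    refine le_antisymm (dyadicCount_le_floor h j) ?_
    push Not at hne
    obtain ⟨n, hn, hn0⟩ := hne (j + 1)
    have h1 : 2 ^ j * x - dyadicCount c j < 1 := by
      refine hasSum_lt (i := n - (j + 1)) (fun m => ?_) ?_ (hasSum_dyadicCount_remainder h j)
        (hasSum_geometric_two' 1)
      · exact mul_le_of_le_one_left (by positivity) (Nat.cast_le_one.2 (hle _))
      · rw [Nat.sub_add_cancel hn, hn0]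
        simp only [Nat.cast_zero, zero_mul]
        positivity
    refine Nat.lt_succ_iff.1 <| (Nat.floor_lt' (by omega)).2 ?_
    push_cast
    linarith

/-- The binary digits of `x`, in the expansion that terminates when `x` is dyadic. -/
noncomputable def dyadicDigit (x : ℝ) : ℕ → ℕ
  | 0 => ⌊x⌋₊
  | j + 1 => ⌊2 ^ (j + 1) * x⌋₊ - 2 * ⌊2 ^ j * x⌋₊

theorem dyadicDigit_eq_zero {x : ℝ} {j : ℕ} (hx : 2 ^ j * x < 1) : dyadicDigit x j = 0 := by
  cases j with
  | zero => exact Nat.floor_eq_zero.2 (by simpa using hx)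
  | succ j => rw [dyadicDigit, Nat.floor_eq_zero.2 hx, Nat.zero_sub]

theorem dyadicCount_dyadicDigit {x : ℝ} (hx : 0 ≤ x) (j : ℕ) :
    dyadicCount (dyadicDigit x) j = ⌊2 ^ j * x⌋₊ := by
  induction j with
  | zero => simp [dyadicCount, dyadicDigit]
  | succ j ih =>
    have := two_mul_floor_le (x := 2 ^ j * x) (by positivity)
    rw [← mul_assoc, ← pow_succ'] at this
    simp only [dyadicCount, ih, dyadicDigit]
    omega

theorem hasSum_dyadicDigit {x : ℝ} (hx : 0 ≤ x) :
    HasSum (fun j => (dyadicDigit x j : ℝ) * (1 / 2) ^ j) x := by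
  rw [hasSum_iff_tendsto_nat_of_nonneg fun j => by positivity,
    ← Filter.tendsto_add_atTop_iff_nat 1]
  simp only [sum_range_eq_dyadicCount (show (2 : ℝ) * (1 / 2) = 1 by norm_num),
    dyadicCount_dyadicDigit hx]
  have hpow : ∀ j : ℕ, (2 : ℝ) ^ j * (1 / 2) ^ j = 1 := fun j => by rw [← mul_pow]; norm_num
  have hlim : Filter.Tendsto (fun j : ℕ => x - (1 / 2 : ℝ) ^ j) Filter.atTop (nhds x) := by
    simpa using tendsto_const_nhds.sub
      (tendsto_pow_atTop_nhds_zero_of_lt_one (r := (1 / 2 : ℝ)) (by norm_num) (by norm_num))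
  refine tendsto_of_tendsto_of_tendsto_of_le_of_le hlim tendsto_const_nhds (fun j => ?_)
    fun j => ?_
  · have := mul_le_mul_of_nonneg_right (Nat.lt_floor_add_one (2 ^ j * x)).le
      (by positivity : (0 : ℝ) ≤ (1 / 2) ^ j)
    dsimp only
    linear_combination this - x * hpow j
  · have := mul_le_mul_of_nonneg_right (Nat.floor_le (by positivity : 0 ≤ 2 ^ j * x))
      (by positivity : (0 : ℝ) ≤ (1 / 2) ^ j)
    dsimp only
    linear_combination this + x * hpow j

/-- The `j` low-order binary digits of `x`, most significant digit first. -/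
def lowBits : ℕ → ℕ → List Bool
  | 0, _ => []
  | j + 1, x => lowBits j (x / 2) ++ [decide (x % 2 = 1)]

@[simp]
theorem length_lowBits (j x : ℕ) : (lowBits j x).length = j := by
  induction j generalizing x with
  | zero => rfl
  | succ j ih => simp [lowBits, ih]

theorem take_lowBits_add (j d x : ℕ) : (lowBits (j + d) x).take j = lowBits j (x / 2 ^ d) := by
  induction d generalizing x with
  | zero => simp [List.take_of_length_le]
  | succ d ih =>
    rw [← add_assoc, lowBits, List.take_append_of_le_length (by simp), ih, Nat.div_div_eq_div_mul,
      ← pow_succ']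

theorem lowBits_injOn (j : ℕ) : Set.InjOn (lowBits j) {x | x < 2 ^ j} := by
  induction j with
  | zero => intro x hx y hy _; simp_all
  | succ j ih =>
    intro x hx y hy hxy
    simp only [Set.mem_ofPred_eq, pow_succ] at hx hy
    obtain ⟨h1, h2⟩ := List.append_inj' hxy rfl
    have h3 : x / 2 = y / 2 :=
      ih (by rw [Set.mem_ofPred_eq]; omega) (by rw [Set.mem_ofPred_eq]; omega) h1
    simp only [List.cons.injEq, decide_eq_decide, and_true] at h2
    omega

theorem eq_div_of_lowBits_prefix {j m x y : ℕ} (hx : x < 2 ^ j) (hy : y < 2 ^ m)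
    (h : lowBits j x <+: lowBits m y) : j ≤ m ∧ x = y / 2 ^ (m - j) := by
  have hjm : j ≤ m := by simpa using h.length_le
  obtain ⟨d, rfl⟩ := Nat.exists_eq_add_of_le hjm
  refine ⟨hjm, lowBits_injOn j hx ?_ ?_⟩
  · simp only [Set.mem_ofPred_eq, add_tsub_cancel_left]
    exact Nat.div_lt_of_lt_mul (by rwa [← pow_add, add_comm d])
  · rw [List.prefix_iff_eq_take, length_lowBits, take_lowBits_add] at h
    simpa using h

theorem two_pow_mul_dyadicCount_le (c : ℕ → ℕ) (j d : ℕ) :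
    2 ^ d * dyadicCount c j ≤ dyadicCount c (j + d) := by
  induction d with
  | zero => simp
  | succ d ih =>
    rw [← add_assoc, dyadicCount, pow_succ']
    linarith

theorem Finset.exists_injOn_lt_card {α : Type*} (D : Finset α) :
    ∃ e : α → ℕ, Set.InjOn e D ∧ ∀ a ∈ D, e a < D.card := by
  classical
  refine ⟨fun a => if h : a ∈ D then D.equivFin ⟨a, h⟩ else 0, fun a ha b hb hab => ?_,
    fun a ha => by simp [ha]⟩
  simp only [Finset.mem_coe] at ha hb
  simp only [ha, hb, dite_true] at hab
  simpa using D.equivFin.injective (Fin.ext hab)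

/-- The converse of Kraft's inequality, with the codewords of length `j` labelled by `D j`. -/
theorem exists_prefixFree_of_dyadicCount_le {I : Type*} (D : ℕ → Finset I)
    (hD : ∀ j, dyadicCount (fun m => (D m).card) j ≤ 2 ^ j) :
    ∃ S : I → Set (List Bool), Pairwise (Function.onFun Disjoint S) ∧
      (∀ w ∈ ⋃ i, S i, ∀ v ∈ ⋃ i, S i, w <+: v → w = v) ∧
      ∀ i j, {w ∈ S i | w.length = j}.ncard = (D j : Set I).indicator 1 i := by
  choose e einj elt using fun j => (D j).exists_injOn_lt_card
  set T := dyadicCount fun m => (D m).card with hT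
  set pos : ℕ → I → ℕ := fun j i => T j - 1 - e j i with hpos
  have hcard : ∀ j, (D j).card ≤ T j := by
    rintro (_ | j)
    · exact le_rfl
    · exact Nat.le_add_left _ _
  have hposlt : ∀ j, ∀ i ∈ D j, pos j i < T j := fun j i hi => by
    have := elt j i hi
    have := hcard j
    simp only [hpos]
    omega
  have hprefix : ∀ j m, ∀ i ∈ D j, ∀ i' ∈ D m,
      lowBits j (pos j i) <+: lowBits m (pos m i') → j = m ∧ i = i' := by
    intro j m i hi i' hi' h
    obtain ⟨hjm, heq⟩ := eq_div_of_lowBits_prefix ((hposlt j i hi).trans_le (hD j))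
      ((hposlt m i' hi').trans_le (hD m)) h
    have h1 := elt j i hi
    have h2 := elt m i' hi'
    have h3 := hcard j
    have h4 := hcard m
    rcases hjm.eq_or_lt with rfl | hlt
    · refine ⟨rfl, einj j hi hi' ?_⟩
      simp only [hpos, tsub_self, pow_zero, Nat.div_one] at heq
      omega
    · exfalso
      obtain ⟨d, rfl⟩ := Nat.exists_eq_add_of_lt hlt
      have h5 : T (j + d + 1) = 2 * T (j + d) + (D (j + d + 1)).card := rfl
      have h6 : 2 ^ d * T j ≤ T (j + d) := two_pow_mul_dyadicCount_le _ j d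
      have h7 : T j ≤ pos (j + d + 1) i' / 2 ^ (j + d + 1 - j) := by
        rw [Nat.le_div_iff_mul_le (by positivity), show j + d + 1 - j = d + 1 by omega, pow_succ]
        simp only [hpos]
        have : T j * (2 ^ d * 2) = 2 * (2 ^ d * T j) := by ring
        omega
      have := hposlt j i hi
      omega
  have hmem : ∀ w i, w ∈ {w | ∃ j, i ∈ D j ∧ w = lowBits j (pos j i)} ↔
      i ∈ D w.length ∧ w = lowBits w.length (pos w.length i) := fun w i =>
    ⟨by rintro ⟨j, hi, rfl⟩; simpa using hi, fun h => ⟨_, h⟩⟩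
  refine ⟨fun i => {w | ∃ j, i ∈ D j ∧ w = lowBits j (pos j i)}, fun i i' hii' => ?_, ?_,
    fun i j => ?_⟩
  · refine Set.disjoint_left.2 ?_
    rintro w ⟨j, hi, rfl⟩ ⟨m, hi', hw⟩
    exact hii' (hprefix j m i hi i' hi' (by rw [hw])).2
  · intro w hw v hv hwv
    simp only [Set.mem_iUnion] at hw hv
    obtain ⟨i, j, hi, rfl⟩ := hw
    obtain ⟨i', m, hi', rfl⟩ := hv
    obtain ⟨rfl, rfl⟩ := hprefix j m i hi i' hi' hwv
    rfl
  · by_cases hi : i ∈ D j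
    · rw [Set.indicator_of_mem (by simpa using hi), Pi.one_apply, Set.ncard_eq_one]
      refine ⟨lowBits j (pos j i), Set.ext fun w => ⟨?_, ?_⟩⟩
      · rintro ⟨⟨m, -, rfl⟩, hw⟩
        rw [length_lowBits] at hw
        rw [hw, Set.mem_singleton_iff]
      · rintro rfl
        exact ⟨⟨j, hi, rfl⟩, length_lowBits _ _⟩
    · rw [Set.indicator_of_notMem (by simpa using hi), Set.ncard_eq_zero
        ((List.finite_length_eq Bool j).subset fun w hw => hw.2), Set.eq_empty_iff_forall_notMem]
      rintro w ⟨⟨m, hm, rfl⟩, hw⟩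
      rw [length_lowBits] at hw
      exact hi (hw ▸ hm)

/-- The number of strings of length `j` in `A`. -/
noncomputable def levelCount (A : Set (List Bool)) (j : ℕ) : ℕ :=
  {w ∈ A | w.length = j}.ncard

theorem finite_level (A : Set (List Bool)) (j : ℕ) : {w ∈ A | w.length = j}.Finite :=
  (List.finite_length_eq Bool j).subset fun _ hw => hw.2

theorem levelCount_le_one_iff {A : Set (List Bool)} {j : ℕ} :
    levelCount A j ≤ 1 ↔ {w ∈ A | w.length = j}.Subsingleton :=
  by
  have := (finite_level A j).to_subtype
  exact Set.ncard_le_one_iff_subsingleton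

theorem levelCount_ne_zero_iff {A : Set (List Bool)} {j : ℕ} :
    levelCount A j ≠ 0 ↔ ∃ w ∈ A, w.length = j :=
  Nat.pos_iff_ne_zero.symm.trans (Set.ncard_pos (finite_level A j))

theorem coe_ddgWt (w : List Bool) : (ddgWt w : ℝ≥0∞) = 2⁻¹ ^ w.length := by
  simp [ddgWt, ENNReal.inv_pow]

theorem tsum_ddgWt_eq_tsum_levelCount (A : Set (List Bool)) :
    ∑' w : A, (ddgWt w : ℝ≥0∞) = ∑' j, (levelCount A j : ℝ≥0∞) * 2⁻¹ ^ j := by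
  have hA : A = ⋃ j, {w ∈ A | w.length = j} := by ext w; simp
  have hd : Set.univ.PairwiseDisjoint fun j : ℕ => {w ∈ A | w.length = j} :=
    fun j _ m _ hjm => Set.disjoint_left.2 fun w hw hw' => hjm (hw.2.symm.trans hw'.2)
  conv_lhs => rw [hA]
  rw [ENNReal.tsum_biUnion (f := fun w => (ddgWt w : ℝ≥0∞)) hd]
  refine tsum_congr fun j => ?_
  rw [tsum_congr (g := fun _ => (2⁻¹ : ℝ≥0∞) ^ j) fun w => by rw [coe_ddgWt, w.2.2],
    ENNReal.tsum_set_const, levelCount, ← (finite_level A j).cast_ncard_eq]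
  simp

theorem tsum_ddgWt_length_le (A : Set (List Bool)) (j : ℕ) :
    ∑' w : {w ∈ A | w.length ≤ j}, (ddgWt w : ℝ≥0∞) =
      dyadicCount (levelCount A) j * 2⁻¹ ^ j := by
  rw [tsum_ddgWt_eq_tsum_levelCount, tsum_eq_sum (s := Finset.range (j + 1)),
    ← sum_range_eq_dyadicCount (ENNReal.mul_inv_cancel two_ne_zero ENNReal.ofNat_ne_top)]
  · refine Finset.sum_congr rfl fun m hm => ?_
    have hmj : m ≤ j := Nat.lt_succ_iff.1 (Finset.mem_range.1 hm)
    rw [show levelCount {w ∈ A | w.length ≤ j} m = levelCount A m from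
      congrArg Set.ncard (Set.ext fun w => ⟨fun h => ⟨h.1.1, h.2⟩,
        fun h => ⟨⟨h.1, h.2.trans_le hmj⟩, h.2⟩⟩)]
  · intro m hm
    have : levelCount {w ∈ A | w.length ≤ j} m = 0 := by
      by_contra h
      obtain ⟨w, hw, rfl⟩ := levelCount_ne_zero_iff.1 h
      exact hm (Finset.mem_range.2 (Nat.lt_succ_of_le hw.2))
    simp [this]

theorem tsum_levelCount_eq_coe_iff {c : ℕ → ℕ} {x : ℝ≥0} :
    ∑' j, (c j : ℝ≥0∞) * 2⁻¹ ^ j = x ↔ HasSum (fun j => (c j : ℝ) * (1 / 2) ^ j) x := by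
  have h1 : ∀ j, (c j : ℝ≥0∞) * 2⁻¹ ^ j = ((c j * 2⁻¹ ^ j : ℝ≥0) : ℝ≥0∞) := fun j => by
    simp [ENNReal.inv_pow]
  have h2 : ∀ j, (c j : ℝ) * (1 / 2) ^ j = ((c j * 2⁻¹ ^ j : ℝ≥0) : ℝ) := fun j => by simp
  simp_rw [h1, h2]
  rw [NNReal.hasSum_coe, ← ENNReal.hasSum_coe, ENNReal.summable.hasSum_iff]

theorem tsum_coe_eq_coe_of_tsum_eq {α : Type*} {f : α → ℝ≥0} {x : ℝ≥0} (hf : Summable f)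
    (h : ∑' a, f a = x) : ∑' a, (f a : ℝ≥0∞) = x := by
  rw [← h, ENNReal.coe_tsum hf]

theorem tsum_eq_of_tsum_coe_eq {α : Type*} {f : α → ℝ≥0} {x : ℝ≥0}
    (h : ∑' a, (f a : ℝ≥0∞) = x) : ∑' a, f a = x := by
  have hf : Summable f := ENNReal.tsum_coe_ne_top_iff_summable.1 (h ▸ ENNReal.coe_ne_top)
  rw [← ENNReal.coe_tsum hf] at h
  exact_mod_cast h

section

variable {I : Type*} {p : I → ℝ≥0} {S : I → Set (List Bool)}

theorem IsDDG.summable_ddgWt (hS : IsDDG p S) {A : Set (List Bool)} (hA : A ⊆ ⋃ i, S i) :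
    Summable fun w : A => ddgWt w := by
  have hU : Summable fun w : (⋃ i, S i : Set (List Bool)) => ddgWt w := by
    by_contra hU
    simpa [tsum_eq_zero_of_not_summable hU] using hS.total
  simpa only [Function.comp_def, Set.coe_inclusion] using
    NNReal.summable_comp_injective hU (Set.inclusion_injective hA)

theorem isDDG_iff (hp : ∑' i, (p i : ℝ≥0∞) = 1) :
    IsDDG p S ↔ Pairwise (Function.onFun Disjoint S) ∧
      (∀ w ∈ ⋃ i, S i, ∀ v ∈ ⋃ i, S i, w <+: v → w = v) ∧
      ∀ i, HasSum (fun j => (levelCount (S i) j : ℝ) * (1 / 2) ^ j) (p i) := by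
  simp_rw [← tsum_levelCount_eq_coe_iff, ← tsum_ddgWt_eq_tsum_levelCount]
  constructor
  · intro h
    refine ⟨h.pairwise_disjoint, h.prefixFree, fun i => ?_⟩
    exact tsum_coe_eq_coe_of_tsum_eq (h.summable_ddgWt (Set.subset_iUnion S i)) (h.mass i)
  · rintro ⟨hd, hpre, hm⟩
    refine ⟨hd, hpre, fun i => tsum_eq_of_tsum_coe_eq (hm i), tsum_eq_of_tsum_coe_eq ?_⟩
    rw [ENNReal.tsum_biUnion (f := fun w => (ddgWt w : ℝ≥0∞)) fun i _ j _ hij => hd hij]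
    simp_rw [hm, hp, ENNReal.coe_one]

theorem coe_ddgTail (hS : IsDDG p S) (j : ℕ) :
    (ddgTail S j : ℝ≥0∞) =
      1 - ∑' i, (dyadicCount (levelCount (S i)) j : ℝ≥0∞) * 2⁻¹ ^ j := by
  have hs : {w ∈ ⋃ i, S i | w.length ≤ j} = ⋃ i, {w ∈ S i | w.length ≤ j} := by ext w; simp
  have hj : Summable fun w : ({w ∈ ⋃ i, S i | w.length ≤ j} : Set (List Bool)) => ddgWt w :=
    hS.summable_ddgWt fun w hw => hw.1
  rw [ddgTail, ENNReal.coe_sub, ENNReal.coe_one, ENNReal.coe_tsum hj, hs,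
    ENNReal.tsum_biUnion (f := fun w => (ddgWt w : ℝ≥0∞)) fun i _ m _ him =>
      (hS.pairwise_disjoint him).mono (fun w hw => hw.1) fun w hw => hw.1]
  simp_rw [tsum_ddgWt_length_le]

theorem dyadicCount_levelCount_le_floor (hp : ∑' i, (p i : ℝ≥0∞) = 1) (hS : IsDDG p S)
    (i : I) (j : ℕ) : dyadicCount (levelCount (S i)) j ≤ ⌊2 ^ j * (p i : ℝ)⌋₊ :=
  dyadicCount_le_floor (((isDDG_iff hp).1 hS).2.2 i) j

theorem tsum_floor_le_one (hp : ∑' i, (p i : ℝ≥0∞) = 1) (j : ℕ) :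
    ∑' i, (⌊2 ^ j * (p i : ℝ)⌋₊ : ℝ≥0∞) * 2⁻¹ ^ j ≤ 1 := by
  rw [← hp]
  refine ENNReal.tsum_le_tsum fun i => ?_
  have h1 : (⌊2 ^ j * (p i : ℝ)⌋₊ : ℝ≥0) ≤ 2 ^ j * p i := by
    rw [← NNReal.coe_le_coe]
    push_cast
    exact Nat.floor_le (by positivity)
  calc (⌊2 ^ j * (p i : ℝ)⌋₊ : ℝ≥0∞) * 2⁻¹ ^ j ≤ 2 ^ j * p i * 2⁻¹ ^ j := by
        gcongr
        exact_mod_cast ENNReal.coe_le_coe.2 h1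
    _ = p i := by
        rw [mul_right_comm, ← mul_pow, ENNReal.mul_inv_cancel two_ne_zero ENNReal.ofNat_ne_top,
          one_pow, one_mul]

theorem exists_isDDG_dyadicCount_eq_floor (hp : ∑' i, (p i : ℝ≥0∞) = 1) :
    ∃ S : I → Set (List Bool), IsDDG p S ∧
      ∀ i j, dyadicCount (levelCount (S i)) j = ⌊2 ^ j * (p i : ℝ)⌋₊ := by
  have hsum : Summable p := 
    ENNReal.tsum_coe_ne_top_iff_summable.1 (by simp [hp])
  have hp1 : ∀ i, (p i : ℝ) ≤ 1 := fun i => by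
    have : (p i : ℝ≥0∞) ≤ 1 := (ENNReal.le_tsum i).trans_eq hp
    exact_mod_cast this
  have hdig : ∀ i j, dyadicDigit (p i) j ≤ 1 := fun i =>
    ((dyadicCount_eq_floor_iff (hp1 i) (hasSum_dyadicDigit (p i).2)).1
      (dyadicCount_dyadicDigit (p i).2)).1
  have hfin : ∀ j, {i | dyadicDigit (p i) j ≠ 0}.Finite := fun j => by
    have hev := (NNReal.tendsto_cofinite_zero_of_summable hsum).eventually_lt_const
      (show (0 : ℝ≥0) < 2⁻¹ ^ j by positivity)
    refine (Filter.eventually_cofinite.1 hev).subset fun i hi hlt => hi ?_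
    refine dyadicDigit_eq_zero ?_
    have h1 : (2 : ℝ≥0) ^ j * p i < 2 ^ j * 2⁻¹ ^ j := by gcongr
    rw [← mul_pow, mul_inv_cancel₀ two_ne_zero, one_pow] at h1
    exact_mod_cast h1
  have hcard : ∀ j, ((hfin j).toFinset.card : ℝ≥0∞) = ∑' i, (dyadicDigit (p i) j : ℝ≥0∞) :=
    fun j => by
      rw [tsum_eq_sum (s := (hfin j).toFinset) fun i hi => by simpa using hi,
        Finset.card_eq_sum_ones, Nat.cast_sum]
      refine Finset.sum_congr rfl fun i hi => ?_
      have := hdig i j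
      have : dyadicDigit (p i) j ≠ 0 := by simpa using hi
      rw [show dyadicDigit (p i) j = 1 by omega]
  have htot : HasSum (fun j => ((hfin j).toFinset.card : ℝ) * (1 / 2) ^ j) (1 : ℝ≥0) := by
    rw [← tsum_levelCount_eq_coe_iff]
    simp_rw [hcard, ← ENNReal.tsum_mul_right]
    rw [ENNReal.tsum_comm, ENNReal.coe_one, ← hp]
    exact tsum_congr fun i => tsum_levelCount_eq_coe_iff.2 (hasSum_dyadicDigit (p i).2)
  obtain ⟨S, hd, hpre, hcount⟩ := exists_prefixFree_of_dyadicCount_le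
    (fun j => (hfin j).toFinset) fun j => by
      have := dyadicCount_le htot j
      rw [NNReal.coe_one, mul_one] at this
      exact_mod_cast this
  have hlevel : ∀ i, levelCount (S i) = dyadicDigit (p i) := fun i => funext fun j => by
    rw [levelCount, hcount]
    have := hdig i j
    by_cases h : dyadicDigit (p i) j = 0
    · simp [h]
    · simp [h]
      omega
  refine ⟨S, (isDDG_iff hp).2 ⟨hd, hpre, fun i => ?_⟩, fun i j => ?_⟩
  · rw [hlevel]
    exact hasSum_dyadicDigit (p i).2
  · rw [hlevel]
    exact dyadicCount_dyadicDigit (p i).2 j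

theorem isOptimalDDG_iff_dyadicCount_eq_floor (hp : ∑' i, (p i : ℝ≥0∞) = 1) (hS : IsDDG p S) :
    IsOptimalDDG p S ↔ ∀ i j, dyadicCount (levelCount (S i)) j = ⌊2 ^ j * (p i : ℝ)⌋₊ := by
  have hle : ∀ {S'}, IsDDG p S' → ∀ i j,
      (dyadicCount (levelCount (S' i)) j : ℝ≥0∞) * 2⁻¹ ^ j ≤
        ⌊2 ^ j * (p i : ℝ)⌋₊ * 2⁻¹ ^ j := fun h i j => by
    gcongr
    exact dyadicCount_levelCount_le_floor hp h i j
  constructor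
  · rintro ⟨-, hopt⟩ i j
    obtain ⟨S', hS', hfl⟩ := exists_isDDG_dyadicCount_eq_floor hp
    have h1 := ENNReal.coe_le_coe.2 (hopt S' hS' j)
    rw [coe_ddgTail hS, coe_ddgTail hS'] at h1
    simp_rw [hfl] at h1
    have h2 := tsum_floor_le_one hp j
    by_contra hne
    have hlt := (dyadicCount_levelCount_le_floor hp hS i j).lt_of_ne hne
    have h3 : ∑' i, (dyadicCount (levelCount (S i)) j : ℝ≥0∞) * 2⁻¹ ^ j <
        ∑' i, (⌊2 ^ j * (p i : ℝ)⌋₊ : ℝ≥0∞) * 2⁻¹ ^ j := by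
      refine ENNReal.tsum_lt_tsum (i := i)
        (ne_top_of_le_ne_top ENNReal.one_ne_top
          ((ENNReal.tsum_le_tsum fun i => hle hS i j).trans h2)) (fun i => hle hS i j) ?_
      exact ENNReal.mul_lt_mul_left (by simp) (by finiteness) (by exact_mod_cast hlt)
    exact h3.not_ge ((ENNReal.sub_le_sub_iff_left h2 ENNReal.one_ne_top).1 h1)
  · refine fun h => ⟨hS, fun S' hS' j => ENNReal.coe_le_coe.1 ?_⟩
    rw [coe_ddgTail hS, coe_ddgTail hS']
    refine tsub_le_tsub_left (ENNReal.tsum_le_tsum fun i => ?_) _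
    rw [h]
    exact hle hS' i j

end

/-- A DDG `S` for a probability mass function `p` on a countable
outcome set is optimal if and only if every outcome appears at most once per level,
and no outcome appears at every level from some point on. -/
theorem ddg_optimal_iff_no_repeats_no_tail {I : Type*} [Countable I]
    (p : I → ℝ≥0) (hp : ∑' i, p i = 1)
    (S : I → Set (List Bool)) (hS : IsDDG p S) :
    IsOptimalDDG p S ↔
      ((∀ (i : I) (j : ℕ), ({w ∈ S i | w.length = j} : Set (List Bool)).Subsingleton) ∧
        ¬ ∃ (i : I) (k : ℕ), ∀ j : ℕ, k ≤ j → ∃ w ∈ S i, w.length = j) := by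
  have hsum : Summable p := by
    by_contra h
    exact zero_ne_one ((tsum_eq_zero_of_not_summable h).symm.trans hp)
  have hp' : ∑' i, (p i : ℝ≥0∞) = 1 := tsum_coe_eq_coe_of_tsum_eq hsum hp
  have hp1 : ∀ i, (p i : ℝ) ≤ 1 := fun i => by
    exact_mod_cast hp ▸ hsum.le_tsum' i
  simp_rw [isOptimalDDG_iff_dyadicCount_eq_floor hp' hS,
    fun i => dyadicCount_eq_floor_iff (hp1 i) (((isDDG_iff hp').1 hS).2.2 i),
    forall_and, levelCount_le_one_iff, levelCount_ne_zero_iff, not_exists]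
end
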